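/- Let P(m,n) = a m² + b m n + c n² + d m + e n + f₀ be an integral bivariate quadratic polynomial with a ≠ 0, c ≠ 0, whose discriminant Δ = b² − 4ac is a positive perfect square. Let Q(m,n) = a m² + b m n + c n² be the associated form, α = 2cd − be, and Γ = Q(e,−d)/Δ + f₀ (a rational number). Let 1 ≤ p < ∞. If the equation P(m,n) = Γ has no solution (m,n) ∈ ℤ², assume λ > 1 − 1/p; otherwise assume λ > max{1/p, 1 − 1/p}. Then there is a constant C (depending only on λ, p, Δ, α) such that for every nonnegative f : ℤ → [0,∞], ∑_{n∈ℤ} ( ∑_{m∈ℤ, m≠0} f(P(m,n)) / |m|^λ )^p ≤ C^p · ∑_{k∈ℤ} f(k)^p (all sums taken in the extended nonnegative reals). -/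

import Mathlib

open scoped ENNReal

/-- The divisor bound `d(n) ≪ n ^ η`. -/
theorem exists_card_divisors_le_mul_rpow {η : ℝ} (hη : 0 < η) :
    ∃ C : ℝ, 0 ≤ C ∧ ∀ n : ℕ, n ≠ 0 → (n.divisors.card : ℝ) ≤ C * (n : ℝ) ^ η := by
  obtain ⟨B, hB⟩ := exists_nat_ge ((2 : ℝ) ^ (1 / η))
  set l : ℝ := η * Real.log 2 with hl
  have hl0 : 0 < l := mul_pos hη (Real.log_pos (by norm_num))
  set K : ℝ := 1 + 1 / l with hK
  have hKl : K * l = l + 1 := by rw [hK]; field_simp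
  have hK1 : 1 ≤ K := by have : 0 < 1 / l := by positivity
                         linarith
  have factor : ∀ p a : ℕ, 2 ≤ p →
      ((a + 1 : ℕ) : ℝ) ≤ (if p < B then K else 1) * ((p : ℝ) ^ η) ^ a := by
    intro p a hp
    have hp' : (2 : ℝ) ≤ p := by exact_mod_cast hp
    split_ifs with h
    · have h1 : 1 + l ≤ (p : ℝ) ^ η := calc
        1 + l ≤ Real.exp l := by linarith [Real.add_one_le_exp l]
        _ = (2 : ℝ) ^ η := by rw [Real.rpow_def_of_pos (by norm_num), hl, mul_comm]
        _ ≤ _ := Real.rpow_le_rpow (by norm_num) hp' hη.le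
      have h2 : 1 + a * l ≤ ((p : ℝ) ^ η) ^ a :=
        (one_add_mul_le_pow (by linarith) a).trans (pow_le_pow_left₀ (by positivity) h1 a)
      calc ((a + 1 : ℕ) : ℝ) ≤ K * (1 + a * l) := by
            push_cast
            have ha : (0 : ℝ) ≤ a := a.cast_nonneg
            nlinarith [mul_nonneg ha hl0.le]
        _ ≤ _ := by gcongr
    · have h1 : (2 : ℝ) ≤ (p : ℝ) ^ η := by
        have : (2 : ℝ) ^ (1 / η) ≤ p := hB.trans (by exact_mod_cast not_lt.mp h)
        calc (2 : ℝ) = ((2 : ℝ) ^ (1 / η)) ^ η := by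
              rw [← Real.rpow_mul (by norm_num), one_div_mul_cancel hη.ne', Real.rpow_one]
          _ ≤ _ := Real.rpow_le_rpow (by positivity) this hη.le
      rw [one_mul]
      calc ((a + 1 : ℕ) : ℝ) ≤ (2 : ℝ) ^ a := by exact_mod_cast Nat.lt_two_pow_self
        _ ≤ _ := by gcongr
  refine ⟨K ^ B, by positivity, fun n hn ↦ ?_⟩
  have hpow : (n : ℝ) ^ η = ∏ p ∈ n.primeFactors, ((p : ℝ) ^ η) ^ n.factorization p := by
    conv_lhs => rw [← Nat.prod_factorization_pow_eq_self hn]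
    rw [Finsupp.prod, Nat.support_factorization, Nat.cast_prod,
      ← Real.finsetProd_rpow _ _ (fun _ _ ↦ by positivity)]
    refine Finset.prod_congr rfl fun p _ ↦ ?_
    rw [Nat.cast_pow, ← Real.rpow_natCast, ← Real.rpow_natCast, ← Real.rpow_mul (by positivity),
      ← Real.rpow_mul (by positivity), mul_comm]
  have hconst : ∏ p ∈ n.primeFactors, (if p < B then K else 1) ≤ K ^ B := by
    rw [← Finset.prod_filter, Finset.prod_const]
    refine pow_le_pow_right₀ hK1 ?_
    calc _ ≤ (Finset.range B).card := Finset.card_le_card fun p hp ↦ by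
          simpa using (Finset.mem_filter.mp hp).2
      _ = B := Finset.card_range B
  rw [Nat.card_divisors hn, hpow, Nat.cast_prod]
  calc ∏ p ∈ n.primeFactors, ((n.factorization p + 1 : ℕ) : ℝ)
      ≤ ∏ p ∈ n.primeFactors, ((if p < B then K else 1) * ((p : ℝ) ^ η) ^ n.factorization p) :=
        Finset.prod_le_prod (fun _ _ ↦ by positivity)
          fun p hp ↦ factor p _ (Nat.prime_of_mem_primeFactors hp).two_le
    _ ≤ _ := by
        rw [Finset.prod_mul_distrib]
        gcongr

/-- The weighted power mean inequality for series. -/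
theorem ENNReal.tsum_mul_rpow_le {ι : Type*} (w g : ι → ℝ≥0∞) {p : ℝ} (hp : 1 ≤ p) :
    (∑' i, w i * g i) ^ p ≤ (∑' i, w i) ^ (p - 1) * ∑' i, w i * g i ^ p := by
  have hp0 : 0 < p := by linarith
  rw [ENNReal.tsum_eq_iSup_sum, ← ENNReal.le_rpow_inv_iff hp0]
  refine iSup_le fun s ↦ ?_
  rw [ENNReal.le_rpow_inv_iff hp0]
  calc (∑ i ∈ s, w i * g i) ^ p
      ≤ ((∑ i ∈ s, w i) ^ (1 - p⁻¹) * (∑ i ∈ s, w i * g i ^ p) ^ p⁻¹) ^ p :=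
        ENNReal.rpow_le_rpow (ENNReal.inner_le_weight_mul_Lp_of_nonneg s hp w g) hp0.le
    _ = (∑ i ∈ s, w i) ^ (p - 1) * ∑ i ∈ s, w i * g i ^ p := by
        rw [ENNReal.mul_rpow_of_nonneg _ _ hp0.le, ← ENNReal.rpow_mul, ← ENNReal.rpow_mul,
          inv_mul_cancel₀ hp0.ne', ENNReal.rpow_one, sub_mul, inv_mul_cancel₀ hp0.ne', one_mul]
    _ ≤ _ := by
        gcongr
        · exact ENNReal.sum_le_tsum s
        · exact ENNReal.sum_le_tsum s

theorem ENNReal.tsum_ite_mem_le_card {ι κ : Type*} [DecidableEq κ] {g : ι → κ}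
    (hg : Function.Injective g) (F : Finset κ) :
    ∑' i, (if g i ∈ F then 1 else 0 : ℝ≥0∞) ≤ F.card := by
  refine (ENNReal.tsum_comp_le_tsum_of_injective hg
    (fun y ↦ if y ∈ F then 1 else 0 : κ → ℝ≥0∞)).trans ?_
  rw [tsum_eq_sum (s := F) (fun y hy ↦ if_neg hy)]
  simp

theorem ENNReal.tsum_ite_eq_zero_le_one {ι : Type*} {g : ι → ℤ} (hg : Function.Injective g) :
    ∑' i, (if g i = 0 then 1 else 0 : ℝ≥0∞) ≤ 1 := by
  simpa using ENNReal.tsum_ite_mem_le_card hg {0}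

theorem natAbs_rpow_eq_ofReal {m : ℤ} (hm : m ≠ 0) (r : ℝ) :
    (m.natAbs : ℝ≥0∞) ^ r = ENNReal.ofReal (|(m : ℝ)| ^ r) := by
  rw [← ENNReal.ofReal_rpow_of_pos (by simpa using hm), ← Int.cast_abs, ← Nat.cast_natAbs,
    ENNReal.ofReal_natCast]

theorem tsum_natAbs_rpow_neg_ne_top {s : ℝ} (hs : 1 < s) :
    ∑' m : {m : ℤ // m ≠ 0}, ((m : ℤ).natAbs : ℝ≥0∞) ^ (-s) ≠ ⊤ := by
  refine ne_top_of_le_ne_top (Real.summable_abs_int_rpow hs).tsum_ofReal_ne_top ?_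
  refine le_trans (le_of_eq (tsum_congr fun m ↦ natAbs_rpow_eq_ofReal m.2 _))
    (ENNReal.tsum_comp_le_tsum_of_injective Subtype.val_injective _)

/-- In a narrow range, `v ^ 2 - t ^ 2` determines `v ^ 2`. -/
theorem abs_le_abs_of_sq_sub_sq_eq {v t v₀ t₀ N : ℤ} (hN : N ≠ 0) (h : v ^ 2 - t ^ 2 = N)
    (h₀ : v₀ ^ 2 - t₀ ^ 2 = N) (ht₀ : t₀ ^ 4 < |N|) : |v₀| ≤ |v| := by
  by_contra! hlt
  have hv0 := abs_nonneg v
  rcases lt_or_gt_of_ne hN with hneg | hpos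
  · rw [abs_of_neg hneg] at ht₀
    nlinarith [sq_nonneg v₀, sq_nonneg t₀]
  · rw [abs_of_pos hpos] at ht₀
    have h1 : t₀ ^ 2 < |v| := by
      refine lt_of_pow_lt_pow_left₀ 2 hv0 ?_
      rw [sq_abs]
      nlinarith [sq_nonneg t]
    have h2 : |v| ≤ v₀ ^ 2 - v ^ 2 := by
      rw [← sq_abs v₀, ← sq_abs v]
      nlinarith
    nlinarith [sq_nonneg t]

theorem exists_intDivisors {N : ℤ} (hN : N ≠ 0) :
    ∃ F : Finset ℤ, (∀ x, x ∣ N → x ∈ F) ∧ F.card ≤ 2 * N.natAbs.divisors.card := by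
  refine ⟨N.natAbs.divisors.image (fun d : ℕ ↦ (d : ℤ)) ∪
    N.natAbs.divisors.image (fun d : ℕ ↦ -(d : ℤ)), fun x hx ↦ ?_, ?_⟩
  · have hd : x.natAbs ∈ N.natAbs.divisors :=
      Nat.mem_divisors.mpr ⟨Int.natAbs_dvd_natAbs.mpr hx, Int.natAbs_ne_zero.mpr hN⟩
    rw [Finset.mem_union, Finset.mem_image, Finset.mem_image]
    rcases Int.natAbs_eq x with h | h
    · exact Or.inl ⟨_, hd, h.symm⟩
    · exact Or.inr ⟨_, hd, h.symm⟩
  · refine (Finset.card_union_le _ _).trans ?_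
    rw [two_mul]
    exact add_le_add Finset.card_image_le Finset.card_image_le

theorem tsum_representations_small_le {δ : ℤ} (hδ : 0 < δ) (α : ℤ) {N : ℤ} (hN : N ≠ 0) :
    ∑' x : {m : ℤ // m ≠ 0} × ℤ,
      (if (δ * x.2) ^ 2 - (δ ^ 2 * x.1 - α) ^ 2 = N ∧ (δ ^ 2 * x.1 - α) ^ 4 < |N|
        then 1 else 0 : ℝ≥0∞) ≤ 4 := by
  by_cases hex : ∃ x : {m : ℤ // m ≠ 0} × ℤ,
      (δ * x.2) ^ 2 - (δ ^ 2 * x.1 - α) ^ 2 = N ∧ (δ ^ 2 * x.1 - α) ^ 4 < |N|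
  · obtain ⟨x₀, h₀, ht₀⟩ := hex
    set v₀ := δ * x₀.2
    set t₀ := δ ^ 2 * (x₀.1 : ℤ) - α
    let g : {m : ℤ // m ≠ 0} × ℤ → ℤ × ℤ := fun x ↦ (δ * x.2, δ ^ 2 * x.1 - α)
    have hg : Function.Injective g := by
      rintro ⟨m, u⟩ ⟨m', u'⟩ h
      simp only [g, Prod.mk.injEq, sub_left_inj] at h
      exact Prod.ext (Subtype.ext (mul_left_cancel₀ (pow_pos hδ 2).ne' h.2))
        (mul_left_cancel₀ hδ.ne' h.1)
    let F : Finset (ℤ × ℤ) := {v₀, -v₀} ×ˢ {t₀, -t₀}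
    have hF : F.card ≤ 4 := by
      rw [Finset.card_product]
      exact Nat.mul_le_mul Finset.card_le_two Finset.card_le_two
    calc _ ≤ ∑' x, (if g x ∈ F then 1 else 0 : ℝ≥0∞) := by
          refine ENNReal.tsum_le_tsum fun x ↦ ?_
          split_ifs with h hx hx
          · exact le_rfl
          · refine absurd ?_ hx
            have hv : |δ * x.2| = |v₀| := le_antisymm
              (abs_le_abs_of_sq_sub_sq_eq hN h₀ h.1 h.2)
              (abs_le_abs_of_sq_sub_sq_eq hN h.1 h₀ ht₀)
            have hv2 := sq_eq_sq_iff_abs_eq_abs _ _ |>.mpr hv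
            have ht : δ ^ 2 * (x.1 : ℤ) - α = t₀ ∨ δ ^ 2 * (x.1 : ℤ) - α = -t₀ :=
              sq_eq_sq_iff_eq_or_eq_neg.mp (by linarith [h.1])
            simp only [F, g, Finset.mem_product, Finset.mem_insert, Finset.mem_singleton]
            exact ⟨abs_eq_abs.mp hv, ht⟩
          · exact zero_le
          · exact le_rfl
      _ ≤ F.card := ENNReal.tsum_ite_mem_le_card hg F
      _ ≤ 4 := by exact_mod_cast hF
  · push Not at hex
    rw [ENNReal.tsum_eq_zero.mpr fun x ↦ if_neg fun h ↦ (hex x h.1).not_gt h.2]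
    exact zero_le

/-- Uniformly in `N ≠ 0`, the weighted number of representations
`N = (δ u) ^ 2 - (δ ^ 2 m - α) ^ 2` is bounded. -/
theorem exists_tsum_representations_le {δ : ℤ} (hδ : 0 < δ) (α : ℤ) {κ : ℝ} (hκ : 0 < κ) :
    ∃ B : ℝ≥0∞, B ≠ ⊤ ∧ ∀ N : ℤ, N ≠ 0 →
      ∑' x : {m : ℤ // m ≠ 0} × ℤ,
        (if (δ * x.2) ^ 2 - (δ ^ 2 * x.1 - α) ^ 2 = N
          then ((x.1 : ℤ).natAbs : ℝ≥0∞) ^ (-κ) else 0) ≤ B := by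
  obtain ⟨C, hC0, hC⟩ := exists_card_divisors_le_mul_rpow (η := κ / 4) (by linarith)
  set K : ℝ := (δ : ℝ) ^ 2 + |(α : ℝ)| with hKdef
  have hδR : (0 : ℝ) < δ := by exact_mod_cast hδ
  have hK : 0 < K := by positivity
  refine ⟨4 + ENNReal.ofReal (2 * C * K ^ κ), by simp, fun N hN ↦ ?_⟩
  obtain ⟨F, hFdvd, hFcard⟩ := exists_intDivisors hN
  let g : {m : ℤ // m ≠ 0} × ℤ → ℤ × ℤ :=
    fun x ↦ (δ * x.2 - (δ ^ 2 * x.1 - α), δ * x.2 + (δ ^ 2 * x.1 - α))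
  have hg : Function.Injective g := by
    rintro ⟨m, u⟩ ⟨m', u'⟩ h
    simp only [g, Prod.mk.injEq] at h
    exact Prod.ext
      (Subtype.ext (mul_left_cancel₀ (pow_pos hδ 2).ne' (by linarith [h.1, h.2])))
      (mul_left_cancel₀ hδ.ne' (by linarith [h.1, h.2]))
  set A : ℝ := (N.natAbs : ℝ) with hA
  have hA0 : 0 < A := by rw [hA]; exact_mod_cast Int.natAbs_pos.mpr hN
  have hsize : ∀ m : ℤ, m ≠ 0 → |N| ≤ (δ ^ 2 * m - α) ^ 4 →
      (m.natAbs : ℝ≥0∞) ^ (-κ) ≤ ENNReal.ofReal (K ^ κ * A ^ (-(κ / 4))) := by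
    intro m hm h
    rw [natAbs_rpow_eq_ofReal hm]
    refine ENNReal.ofReal_le_ofReal ?_
    have hm1 : (1 : ℝ) ≤ |(m : ℝ)| := by exact_mod_cast Int.one_le_abs hm
    have hm0 : (0 : ℝ) < |(m : ℝ)| := by linarith
    have hR : A ≤ ((δ : ℝ) ^ 2 * m - α) ^ 4 := by
      rw [hA, Nat.cast_natAbs]; exact_mod_cast h
    have ht : |(δ : ℝ) ^ 2 * m - α| ≤ K * |(m : ℝ)| := calc
      _ ≤ |(δ : ℝ) ^ 2 * m| + |(α : ℝ)| := abs_sub _ _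
      _ = (δ : ℝ) ^ 2 * |(m : ℝ)| + |(α : ℝ)| := by
          rw [abs_mul, abs_of_pos (pow_pos hδR 2)]
      _ ≤ K * |(m : ℝ)| := by rw [hKdef]; nlinarith [abs_nonneg (α : ℝ)]
    have h4 : A ≤ (K * |(m : ℝ)|) ^ (4 : ℝ) := by
      rw [show (4 : ℝ) = (4 : ℕ) by norm_num, Real.rpow_natCast]
      refine hR.trans ?_
      rw [← Even.pow_abs (by decide : Even 4)]
      exact pow_le_pow_left₀ (abs_nonneg _) ht 4
    have h5 : A ^ (κ / 4) ≤ K ^ κ * |(m : ℝ)| ^ κ := calc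
      _ ≤ ((K * |(m : ℝ)|) ^ (4 : ℝ)) ^ (κ / 4) := Real.rpow_le_rpow hA0.le h4 (by positivity)
      _ = _ := by rw [← Real.rpow_mul (by positivity), mul_div_cancel₀ _ (by norm_num),
                    Real.mul_rpow hK.le hm0.le]
    rw [Real.rpow_neg hm0.le, Real.rpow_neg hA0.le, ← div_eq_mul_inv, inv_eq_one_div,
      div_le_div_iff₀ (by positivity) (by positivity)]
    linarith
  calc _ ≤ ∑' x : {m : ℤ // m ≠ 0} × ℤ,
        ((if (δ * x.2) ^ 2 - (δ ^ 2 * x.1 - α) ^ 2 = N ∧ (δ ^ 2 * x.1 - α) ^ 4 < |N|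
          then 1 else 0 : ℝ≥0∞) +
        (if (δ * x.2) ^ 2 - (δ ^ 2 * x.1 - α) ^ 2 = N ∧ |N| ≤ (δ ^ 2 * x.1 - α) ^ 4
          then ENNReal.ofReal (K ^ κ * A ^ (-(κ / 4))) else 0 : ℝ≥0∞)) := by
        refine ENNReal.tsum_le_tsum fun x ↦ ?_
        by_cases hx : (δ * x.2) ^ 2 - (δ ^ 2 * (x.1 : ℤ) - α) ^ 2 = N
        · rcases lt_or_ge ((δ ^ 2 * (x.1 : ℤ) - α) ^ 4) |N| with h | h
          · simp only [hx, h, h.not_ge, and_self, and_false, if_true, if_false, add_zero]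
            rw [ENNReal.rpow_neg, ENNReal.inv_le_one]
            refine ENNReal.one_le_rpow ?_ hκ
            exact_mod_cast Nat.one_le_iff_ne_zero.mpr (Int.natAbs_ne_zero.mpr x.1.2)
          · simp only [hx, h, h.not_gt, and_self, and_false, if_true, if_false, zero_add]
            exact hsize _ x.1.2 h
        · simp [hx]
    _ ≤ 4 + ENNReal.ofReal (2 * C * K ^ κ) := by
        rw [ENNReal.tsum_add]
        refine add_le_add (tsum_representations_small_le hδ α hN) ?_
        let F' : Finset (ℤ × ℤ) := F.image fun x ↦ (x, N / x)
        have hreal : (F'.card : ℝ) * (K ^ κ * A ^ (-(κ / 4))) ≤ 2 * C * K ^ κ := by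
          have h1 : (F'.card : ℝ) ≤ 2 * (C * A ^ (κ / 4)) := calc
            (F'.card : ℝ) ≤ 2 * (N.natAbs.divisors.card : ℝ) := by
              exact_mod_cast Finset.card_image_le.trans hFcard
            _ ≤ _ := by gcongr; exact hC _ (Int.natAbs_ne_zero.mpr hN)
          have h2 : A ^ (κ / 4) * A ^ (-(κ / 4)) = 1 := by
            rw [← Real.rpow_add hA0, add_neg_cancel, Real.rpow_zero]
          calc _ ≤ 2 * (C * A ^ (κ / 4)) * (K ^ κ * A ^ (-(κ / 4))) := by gcongr
            _ = 2 * C * K ^ κ * (A ^ (κ / 4) * A ^ (-(κ / 4))) := by ring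
            _ = _ := by rw [h2, mul_one]
        calc _ ≤ ∑' x, (if g x ∈ F' then 1 else 0 : ℝ≥0∞) *
              ENNReal.ofReal (K ^ κ * A ^ (-(κ / 4))) := by
              refine ENNReal.tsum_le_tsum fun x ↦ ?_
              split_ifs with h hx hx
              · rw [one_mul]
              · refine absurd ?_ hx
                have hmul : (g x).1 * (g x).2 = N := by rw [← h.1]; simp only [g]; ring
                have h0 : (g x).1 ≠ 0 := by
                  intro h0
                  rw [h0, zero_mul] at hmul
                  exact hN hmul.symm
                refine Finset.mem_image.mpr ⟨(g x).1, hFdvd _ ⟨_, hmul.symm⟩, ?_⟩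
                exact Prod.ext rfl (by rw [← hmul, Int.mul_ediv_cancel_left _ h0])
              · exact zero_le
              · exact zero_le
          _ ≤ F'.card * ENNReal.ofReal (K ^ κ * A ^ (-(κ / 4))) := by
              rw [ENNReal.tsum_mul_right]
              gcongr
              exact ENNReal.tsum_ite_mem_le_card hg F'
          _ ≤ _ := by
              rw [← ENNReal.ofReal_natCast, ← ENNReal.ofReal_mul (by positivity)]
              exact ENNReal.ofReal_le_ofReal hreal

theorem ite_mul_eq_zero_le (x y : ℤ) :
    (if x * y = 0 then 1 else 0 : ℝ≥0∞) ≤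
      (if x = 0 then 1 else 0) + (if y = 0 then 1 else 0) := by
  by_cases hx : x = 0 <;> by_cases hy : y = 0 <;> simp [hx, hy]

/-- For `N = 0` the representations lie on two lines. -/
theorem tsum_representations_zero_le {δ : ℤ} (hδ : 0 < δ) (α : ℤ) (h : ℤ → ℝ≥0∞) :
    ∑' x : {m : ℤ // m ≠ 0} × ℤ,
      (if (δ * x.2) ^ 2 - (δ ^ 2 * x.1 - α) ^ 2 = 0 then h x.1 else 0) ≤
        2 * ∑' m : {m : ℤ // m ≠ 0}, h m := by
  rw [ENNReal.tsum_prod', ← ENNReal.tsum_mul_left]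
  refine ENNReal.tsum_le_tsum fun m ↦ ?_
  set t := δ ^ 2 * (m : ℤ) - α
  calc _ = (∑' u : ℤ, (if (δ * u - t) * (δ * u + t) = 0 then 1 else 0 : ℝ≥0∞)) * h m := by
        rw [← ENNReal.tsum_mul_right]
        refine tsum_congr fun u ↦ ?_
        rw [ite_mul, one_mul, zero_mul]
        congr 2
        ring
    _ ≤ (1 + 1) * h m := by
        gcongr
        refine (ENNReal.tsum_le_tsum fun u ↦ ite_mul_eq_zero_le _ _).trans ?_
        rw [ENNReal.tsum_add]
        refine add_le_add (ENNReal.tsum_ite_eq_zero_le_one fun u u' huu ↦ ?_)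
          (ENNReal.tsum_ite_eq_zero_le_one fun u u' huu ↦ ?_)
        · exact mul_left_cancel₀ hδ.ne' (sub_left_inj.mp huu)
        · exact mul_left_cancel₀ hδ.ne' (add_right_cancel huu)
    _ = 2 * h m := by norm_num


theorem four_mul_mul_quadratic_eq {a b c d e f₀ δ α : ℤ} (hΔ : b ^ 2 - 4 * a * c = δ ^ 2)
    (hα : 2 * c * d - b * e = α) (m n : ℤ) :
    (δ * (2 * c * n + b * m + e)) ^ 2 - (δ ^ 2 * m - α) ^ 2 =
      4 * c * δ ^ 2 * (a * m ^ 2 + b * m * n + c * n ^ 2 + d * m + e * n + f₀) -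
        4 * c * (δ ^ 2 * f₀ + (a * e ^ 2 - b * d * e + c * d ^ 2)) := by
  subst hα
  linear_combination (δ ^ 2 * m ^ 2 - e ^ 2) * hΔ

/-- Discrete fractional integral along an integral bivariate quadratic polynomial
with positive square discriminant `δ^2` and `a ≠ 0`, `c ≠ 0`:
`ℓ^p` boundedness for `λ > 1 - 1/p`, provided additionally `λ > 1/p` in case the
equation `P(m,n) = Γ` is solvable in integers, where `Γ = Q(e,-d)/Δ + f₀`.
The constant depends only on `λ, p, Δ, α`. -/
theorem stmt_2 (p lam : ℝ) (hp : 1 ≤ p) (δ : ℤ) (hδ : 0 < δ) (α : ℤ)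
    (hlam : 1 - 1 / p < lam) :
    ∃ C : ℝ≥0∞, C ≠ ⊤ ∧
      ∀ a b c d e f₀ : ℤ, a ≠ 0 → c ≠ 0 → b ^ 2 - 4 * a * c = δ ^ 2 →
        2 * c * d - b * e = α →
        ((∃ m n : ℤ,
            ((a * m ^ 2 + b * m * n + c * n ^ 2 + d * m + e * n + f₀ : ℤ) : ℚ) =
              ((a * e ^ 2 - b * d * e + c * d ^ 2 : ℤ) : ℚ) / ((δ ^ 2 : ℤ) : ℚ) +
                (f₀ : ℚ)) →
          1 / p < lam) →
        ∀ f : ℤ → ℝ≥0∞,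
          ∑' n : ℤ,
              (∑' m : {m : ℤ // m ≠ 0},
                  f (a * (m : ℤ) ^ 2 + b * (m : ℤ) * n + c * n ^ 2 +
                      d * (m : ℤ) + e * n + f₀) /
                    (((m : ℤ).natAbs : ℝ≥0∞)) ^ lam) ^ p
            ≤ C ^ p * ∑' k : ℤ, f k ^ p := by
  have hp0 : 0 < p := by linarith
  set κ : ℝ := lam - 1 + 1 / p with hκ
  have hκ0 : 0 < κ := by linarith
  have hexp : -(1 + κ) + (1 + κ - lam) * p = -κ := by
    have : κ * p = lam * p - p + 1 := by rw [hκ]; field_simp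
    nlinarith
  obtain ⟨B, hB, hBN⟩ := exists_tsum_representations_le hδ α hκ0
  set S : ℝ≥0∞ := ∑' m : {m : ℤ // m ≠ 0}, ((m : ℤ).natAbs : ℝ≥0∞) ^ (-(1 + κ)) with hS
  have hStop : S ≠ ⊤ := tsum_natAbs_rpow_neg_ne_top (by linarith)
  set B₀ : ℝ≥0∞ := if 1 < lam * p then
    2 * ∑' m : {m : ℤ // m ≠ 0}, ((m : ℤ).natAbs : ℝ≥0∞) ^ (-(lam * p)) else 0 with hB₀
  have hB₀top : B₀ ≠ ⊤ := by
    rw [hB₀]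
    split_ifs with h
    · exact ENNReal.mul_ne_top (by norm_num) (tsum_natAbs_rpow_neg_ne_top h)
    · simp
  refine ⟨((2 + S) ^ (p - 1) * (B + B₀)) ^ p⁻¹, ?_, ?_⟩
  · refine ENNReal.rpow_ne_top_of_nonneg (by positivity) (ENNReal.mul_ne_top ?_ ?_)
    · exact ENNReal.rpow_ne_top_of_nonneg (by linarith) (by simp [hStop])
    · simp [hB, hB₀top]
  intro a b c d e f₀ ha hc hΔ hα hΓ f
  rw [ENNReal.rpow_inv_rpow hp0.ne']
  set P : ℤ → ℤ → ℤ := fun m n ↦ a * m ^ 2 + b * m * n + c * n ^ 2 + d * m + e * n + f₀ with hP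
  set u : ℤ → ℤ → ℤ := fun m n ↦ 2 * c * n + b * m + e with hu
  set N : ℤ → ℤ := fun k ↦
    4 * c * δ ^ 2 * k - 4 * c * (δ ^ 2 * f₀ + (a * e ^ 2 - b * d * e + c * d ^ 2)) with hN
  have hid : ∀ m n, (δ * u m n) ^ 2 - (δ ^ 2 * m - α) ^ 2 = N (P m n) :=
    fun m n ↦ four_mul_mul_quadratic_eq hΔ hα m n
  set w : {m : ℤ // m ≠ 0} → ℤ → ℝ≥0∞ := fun m n ↦
    if N (P m n) = 0 then 1 else ((m : ℤ).natAbs : ℝ≥0∞) ^ (-(1 + κ)) with hw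
  set g : {m : ℤ // m ≠ 0} → ℤ → ℝ≥0∞ := fun m n ↦
    if N (P m n) = 0 then ((m : ℤ).natAbs : ℝ≥0∞) ^ (-lam)
      else ((m : ℤ).natAbs : ℝ≥0∞) ^ (1 + κ - lam) with hg
  set V : {m : ℤ // m ≠ 0} → ℤ → ℝ≥0∞ := fun m k ↦
    if N k = 0 then ((m : ℤ).natAbs : ℝ≥0∞) ^ (-(lam * p))
      else ((m : ℤ).natAbs : ℝ≥0∞) ^ (-κ) with hV
  have hne : ∀ m : {m : ℤ // m ≠ 0}, ((m : ℤ).natAbs : ℝ≥0∞) ≠ 0 :=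
    fun m ↦ by exact_mod_cast Int.natAbs_ne_zero.mpr m.2
  have hnt : ∀ m : {m : ℤ // m ≠ 0}, ((m : ℤ).natAbs : ℝ≥0∞) ≠ ⊤ :=
    fun m ↦ ENNReal.natCast_ne_top _
  have hwg : ∀ m n, w m n * g m n = (((m : ℤ).natAbs : ℝ≥0∞) ^ lam)⁻¹ := by
    intro m n
    rw [← ENNReal.rpow_neg]
    simp only [hw, hg]
    split_ifs
    · rw [one_mul]
    · rw [← ENNReal.rpow_add _ _ (hne m) (hnt m)]
      congr 1; ring
  have hwgp : ∀ m n, w m n * g m n ^ p = V m (P m n) := by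
    intro m n
    simp only [hw, hg, hV]
    split_ifs
    · rw [one_mul, ← ENNReal.rpow_mul, neg_mul]
    · rw [← ENNReal.rpow_mul, ← ENNReal.rpow_add _ _ (hne m) (hnt m), hexp]
  have hwsum : ∀ n, ∑' m, w m n ≤ 2 + S := by
    intro n
    have hbb : (b - δ) * (b + δ) ≠ 0 := by
      have : (b - δ) * (b + δ) = 4 * a * c := by linarith
      rw [this]
      exact mul_ne_zero (mul_ne_zero (by norm_num) ha) hc
    have hsplit : ∀ m : {m : ℤ // m ≠ 0}, w m n ≤
        ((if δ * u m n - (δ ^ 2 * m - α) = 0 then 1 else 0) +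
          (if δ * u m n + (δ ^ 2 * m - α) = 0 then 1 else 0)) +
        ((m : ℤ).natAbs : ℝ≥0∞) ^ (-(1 + κ)) := by
      intro m
      refine le_trans ?_ (add_le_add_left (ite_mul_eq_zero_le _ _) _)
      have : (δ * u m n - (δ ^ 2 * m - α)) * (δ * u m n + (δ ^ 2 * m - α)) = N (P m n) := by
        rw [← hid]; ring
      rw [this]
      simp only [hw]
      split_ifs
      · exact le_self_add
      · rw [zero_add]
    refine (ENNReal.tsum_le_tsum hsplit).trans ?_
    rw [ENNReal.tsum_add, ENNReal.tsum_add]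
    refine add_le_add ((add_le_add
      (ENNReal.tsum_ite_eq_zero_le_one fun m m' hmm ↦ Subtype.ext ?_)
      (ENNReal.tsum_ite_eq_zero_le_one fun m m' hmm ↦ Subtype.ext ?_)).trans
      one_add_one_eq_two.le) le_rfl
    · simp only [hu] at hmm
      refine mul_left_cancel₀ (mul_ne_zero hδ.ne' (left_ne_zero_of_mul hbb)) ?_
      linarith
    · simp only [hu] at hmm
      refine mul_left_cancel₀ (mul_ne_zero hδ.ne' (right_ne_zero_of_mul hbb)) ?_
      linarith
  have hVsum : ∀ k, ∑' x : {m : ℤ // m ≠ 0} × ℤ,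
      (if P x.1 x.2 = k then V x.1 k else 0) ≤ B + B₀ := by
    intro k
    have hinj : Function.Injective
        (fun x : {m : ℤ // m ≠ 0} × ℤ ↦ ((x.1, u x.1 x.2) : {m : ℤ // m ≠ 0} × ℤ)) := by
      rintro ⟨m, n⟩ ⟨m', n'⟩ h
      simp only [hu, Prod.mk.injEq] at h
      obtain ⟨rfl, h⟩ := h
      exact Prod.ext rfl (mul_left_cancel₀ (mul_ne_zero two_ne_zero hc) (by linarith))
    by_cases hk : N k = 0
    · by_cases hex : ∃ x : {m : ℤ // m ≠ 0} × ℤ, P x.1 x.2 = k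
      · have hlp : 1 < lam * p := by
          obtain ⟨⟨m, n⟩, hmn⟩ := hex
          rw [← div_lt_iff₀ hp0]
          refine hΓ ⟨m, n, ?_⟩
          change ((P m n : ℤ) : ℚ) = _
          rw [hmn]
          have hz : δ ^ 2 * k = δ ^ 2 * f₀ + (a * e ^ 2 - b * d * e + c * d ^ 2) := by
            refine mul_left_cancel₀ (mul_ne_zero four_ne_zero hc) ?_
            simp only [hN] at hk
            linarith
          have hδq : (δ : ℚ) ≠ 0 := by exact_mod_cast hδ.ne'
          have hzq : ((δ ^ 2 * k : ℤ) : ℚ) =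
            ((δ ^ 2 * f₀ + (a * e ^ 2 - b * d * e + c * d ^ 2) : ℤ) : ℚ) := by rw [hz]
          push_cast at hzq ⊢
          field_simp
          linarith
        refine le_trans ?_ le_add_self
        rw [hB₀, if_pos hlp]
        refine le_trans ?_ (tsum_representations_zero_le hδ α
          fun m ↦ (m.natAbs : ℝ≥0∞) ^ (-(lam * p)))
        refine le_trans (ENNReal.tsum_le_tsum fun x ↦ ?_)
          (ENNReal.tsum_comp_le_tsum_of_injective hinj _)
        simp only [hid, hV]
        split_ifs with h1 h2
        · exact le_rfl
        · exact absurd (h1 ▸ hk) h2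
        all_goals exact zero_le
      · push Not at hex
        rw [ENNReal.tsum_eq_zero.mpr fun x ↦ if_neg (hex x)]
        exact zero_le
    · refine le_trans ?_ ((hBN _ hk).trans le_self_add)
      refine le_trans (ENNReal.tsum_le_tsum fun x ↦ ?_)
        (ENNReal.tsum_comp_le_tsum_of_injective hinj _)
      simp only [hid, hV, hk, if_false]
      split_ifs with h1 h2
      · exact le_rfl
      · exact absurd (h1 ▸ rfl) h2
      all_goals exact zero_le
  calc _ = ∑' n : ℤ, (∑' m, w m n * (g m n * f (P m n))) ^ p := by
        refine tsum_congr fun n ↦ ?_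
        congr 1
        refine tsum_congr fun m ↦ ?_
        rw [← mul_assoc, hwg, div_eq_mul_inv, mul_comm (f _)]
    _ ≤ ∑' n : ℤ, (2 + S) ^ (p - 1) * ∑' m, V m (P m n) * f (P m n) ^ p := by
        refine ENNReal.tsum_le_tsum fun n ↦ (ENNReal.tsum_mul_rpow_le _ _ hp).trans ?_
        refine mul_le_mul' (ENNReal.rpow_le_rpow (hwsum n) (by linarith)) (le_of_eq ?_)
        refine tsum_congr fun m ↦ ?_
        rw [ENNReal.mul_rpow_of_nonneg _ _ hp0.le, ← mul_assoc, hwgp]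
    _ = (2 + S) ^ (p - 1) * ∑' k : ℤ, (∑' x : {m : ℤ // m ≠ 0} × ℤ,
          (if P x.1 x.2 = k then V x.1 k else 0)) * f k ^ p := by
        rw [ENNReal.tsum_mul_left, ENNReal.tsum_comm, ← ENNReal.tsum_prod]
        simp_rw [← ENNReal.tsum_mul_right]
        rw [ENNReal.tsum_comm]
        congr 1
        refine tsum_congr fun x ↦ ?_
        rw [tsum_eq_single (P x.1 x.2) fun k hk ↦ by rw [if_neg hk.symm, zero_mul], if_pos rfl]
    _ ≤ (2 + S) ^ (p - 1) * ∑' k : ℤ, (B + B₀) * f k ^ p := by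
        gcongr with k
        exact hVsum k
    _ = _ := by rw [ENNReal.tsum_mul_left, mul_assoc]
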